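/- Let n be an odd positive integer, m a positive divisor of n, F the finite field with 2^n elements, i a positive integer with gcd(i,n) = 1, and f : F → F the Gold function f(x) = x^(2^i+1). Let μ ∈ F, μ ≠ 0. Then Z = { (μa, μ^(2^i+1)·b) : a ∈ F, b ∈ F_{2^m}, Tr^n_m(a) = b + b^(2^(n−i)) } is a WZ space of f. -/

import Mathlib

noncomputable instance (n : ℕ) : Fintype (GaloisField 2 n) := Fintype.ofFinite _

/-- The absolute trace from `GF(2^n)` to `𝔽₂`. -/
noncomputable def Tr (n : ℕ) : GaloisField 2 n → ZMod 2 :=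
  Algebra.trace (ZMod 2) (GaloisField 2 n)

/-- The Walsh transform of `f : GF(2^n) → GF(2^n)` at `(a, b)`. -/
noncomputable def W (n : ℕ) (f : GaloisField 2 n → GaloisField 2 n)
    (a b : GaloisField 2 n) : ℤ :=
  ∑ x : GaloisField 2 n, (-1) ^ (Tr n (a * x + b * f x)).val

/-- A WZ space of `f`: an `𝔽₂`-subspace of `GF(2^n) × GF(2^n)` of dimension `n`
all of whose nonzero elements are Walsh zeros of `f`. -/
def IsWZSpace (n : ℕ) (f : GaloisField 2 n → GaloisField 2 n)
    (S : Submodule (ZMod 2) (GaloisField 2 n × GaloisField 2 n)) : Prop :=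
  Module.finrank (ZMod 2) S = n ∧
    ∀ p ∈ S, p ≠ (0 : GaloisField 2 n × GaloisField 2 n) → W n f p.1 p.2 = 0



theorem tr_add (n : ℕ) (x y : GaloisField 2 n) : Tr n (x + y) = Tr n x + Tr n y :=
  map_add (Algebra.trace (ZMod 2) (GaloisField 2 n)) x y

theorem tr_sum (n : ℕ) {ι : Type*} (s : Finset ι) (g : ι → GaloisField 2 n) :
    Tr n (∑ j ∈ s, g j) = ∑ j ∈ s, Tr n (g j) :=
  map_sum (Algebra.trace (ZMod 2) (GaloisField 2 n)) g s

theorem tr_pow (n k : ℕ) (x : GaloisField 2 n) : Tr n (x ^ 2 ^ k) = Tr n x := by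
  induction k with
  | zero => simp
  | succ k ih =>
    rw [pow_succ, pow_mul, ← ih]
    have := Algebra.trace_eq_of_algEquiv
      (FiniteField.frobeniusAlgEquivOfAlgebraic (ZMod 2) (GaloisField 2 n)) (x ^ 2 ^ k)
    simpa [Tr] using this

theorem tr_one (n : ℕ) (hn : 0 < n) (hodd : Odd n) : Tr n 1 = 1 := by
  have h := Algebra.trace_algebraMap (S := GaloisField 2 n) (1 : ZMod 2)
  rw [map_one, GaloisField.finrank 2 hn.ne'] at h
  unfold Tr
  rw [h, nsmul_one]
  exact (ZMod.natCast_eq_one_iff_odd).2 hodd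

theorem pow_card' (n : ℕ) (hn : 0 < n) (x : GaloisField 2 n) : x ^ 2 ^ n = x := by
  have h := FiniteField.pow_card x
  rwa [← Nat.card_eq_fintype_card, GaloisField.card 2 n hn.ne'] at h

theorem add_frob (n k : ℕ) (x y : GaloisField 2 n) :
    (x + y) ^ 2 ^ k = x ^ 2 ^ k + y ^ 2 ^ k := add_pow_char_pow x y 2 k

theorem fix_pow (n m j : ℕ) (b : GaloisField 2 n) (hb : b ^ 2 ^ m = b) :
    b ^ 2 ^ (m * j) = b := by
  induction j with
  | zero => simp
  | succ j ih => rw [mul_add, pow_add, pow_mul, ih, mul_one, hb]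

theorem coprime_gold (n i : ℕ) (hodd : Odd n) (hgcd : Nat.gcd i n = 1) :
    Nat.Coprime (2 ^ n - 1) (2 ^ i + 1) := by
  have h1 : (2 ^ i + 1) ∣ 2 ^ (2 * i) - 1 := by
    refine ⟨2 ^ i - 1, ?_⟩
    rw [mul_comm 2 i, pow_mul]
    simpa using Nat.sq_sub_sq (2 ^ i) 1
  have h2 : Nat.Coprime (2 * i) n := by
    apply Nat.Coprime.mul_left
    · exact (Nat.coprime_two_left).2 hodd
    · exact hgcd
  have h3 : Nat.gcd (2 ^ (2 * i) - 1) (2 ^ n - 1) = 1 := by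
    rw [Nat.pow_sub_one_gcd_pow_sub_one, h2]
    rfl
  exact (Nat.Coprime.coprime_dvd_left h1 h3).symm

/-- Existence and uniqueness of Gold roots. -/
theorem gold_root (n i m : ℕ) (hn : 0 < n) (hodd : Odd n) (hgcd : Nat.gcd i n = 1)
    (b : GaloisField 2 n) (hb0 : b ≠ 0) (hb : b ^ 2 ^ m = b) :
    ∃ w : GaloisField 2 n, w ≠ 0 ∧ w ^ 2 ^ m = w ∧ w ^ (2 ^ i + 1) = b := by
  have hc : Nat.Coprime (Nat.card (GaloisField 2 n)ˣ) (2 ^ i + 1) := by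
    rw [Nat.card_units, GaloisField.card 2 n hn.ne']
    exact coprime_gold n i hodd hgcd
  obtain ⟨w, hw⟩ := (powCoprime hc).surjective (Units.mk0 b hb0)
  have hw' : w ^ (2 ^ i + 1) = Units.mk0 b hb0 := hw
  refine ⟨w, w.ne_zero, ?_, ?_⟩
  · have : w ^ 2 ^ m = w := by
      apply (powCoprime hc).injective
      change (w ^ 2 ^ m) ^ (2 ^ i + 1) = w ^ (2 ^ i + 1)
      rw [← pow_mul, mul_comm, pow_mul, hw']
      ext
      simpa using hb
    exact_mod_cast congrArg Units.val this
  · simpa using congrArg Units.val hw'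

/-- The relative trace as an `𝔽₂`-linear map. -/
noncomputable def frobLin (n k : ℕ) : GaloisField 2 n →ₗ[ZMod 2] GaloisField 2 n :=
  (iterateFrobenius (GaloisField 2 n) 2 k).toAddMonoidHom.toZModLinearMap 2

theorem frobLin_apply (n k : ℕ) (x : GaloisField 2 n) : frobLin n k x = x ^ 2 ^ k := by
  simp [frobLin, iterateFrobenius_def]

noncomputable def relTr (n m : ℕ) : GaloisField 2 n →ₗ[ZMod 2] GaloisField 2 n :=
  ∑ j ∈ Finset.range (n / m), frobLin n (m * j)

theorem relTr_apply (n m : ℕ) (x : GaloisField 2 n) :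
    relTr n m x = ∑ j ∈ Finset.range (n / m), x ^ 2 ^ (m * j) := by
  simp [relTr, frobLin_apply]

theorem odd_div (n m : ℕ) (hodd : Odd n) (hmn : m ∣ n) : Odd (n / m) :=
  hodd.of_dvd_nat (Nat.div_dvd_of_dvd hmn)

theorem relTr_fix (n m : ℕ) (hodd : Odd n) (hmn : m ∣ n) (b : GaloisField 2 n)
    (hb : b ^ 2 ^ m = b) : relTr n m b = b := by
  rw [relTr_apply, Finset.sum_congr rfl (fun j _ => fix_pow n m j b hb)]
  obtain ⟨k, hk⟩ := odd_div n m hodd hmn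
  rw [Finset.sum_const, Finset.card_range, hk, nsmul_eq_mul]
  push_cast
  have h2 : (2 : GaloisField 2 n) = 0 := CharTwo.two_eq_zero
  linear_combination (k : GaloisField 2 n) * b * h2

theorem relTr_mem (n m : ℕ) (hn : 0 < n) (hmn : m ∣ n) (x : GaloisField 2 n) :
    (relTr n m x) ^ 2 ^ m = relTr n m x := by
  rw [← frobLin_apply, relTr_apply, map_sum]
  simp only [frobLin_apply, ← pow_mul, ← pow_add]
  have h1 := Finset.sum_range_succ (fun j => x ^ 2 ^ (m * j)) (n / m)
  have h2 := Finset.sum_range_succ' (fun j => x ^ 2 ^ (m * j)) (n / m)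
  rw [h1, Nat.mul_div_cancel' hmn, pow_card' n hn] at h2
  simp only [mul_zero, pow_zero, pow_one, mul_add, mul_one] at h2
  exact (add_right_cancel h2).symm

theorem tr_relTr (n m : ℕ) (hodd : Odd n) (hmn : m ∣ n) (u a : GaloisField 2 n)
    (hu : u ^ 2 ^ m = u) : Tr n (u * relTr n m a) = Tr n (u * a) := by
  rw [relTr_apply, Finset.mul_sum, tr_sum]
  have : ∀ j ∈ Finset.range (n / m), Tr n (u * a ^ 2 ^ (m * j)) = Tr n (u * a) := by
    intro j _
    rw [← tr_pow n (m * j) (u * a), mul_pow, fix_pow n m j u hu]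
  rw [Finset.sum_congr rfl this, Finset.sum_const, Finset.card_range, nsmul_eq_mul,
    (ZMod.natCast_eq_one_iff_odd).2 (odd_div n m hodd hmn), one_mul]

theorem W_zero (n : ℕ) (f : GaloisField 2 n → GaloisField 2 n) (A B v : GaloisField 2 n)
    (h : ∀ x, Tr n (A * (x + v) + B * f (x + v)) = Tr n (A * x + B * f x) + 1) :
    W n f A B = 0 := by
  have h1 : W n f A B = - W n f A B := by
    conv_lhs => unfold W
    rw [← Equiv.sum_comp (Equiv.addRight v)]
    unfold W
    rw [← Finset.sum_neg_distrib]
    refine Finset.sum_congr rfl fun x _ => ?_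
    simp only [Equiv.coe_addRight, h]
    generalize Tr n (A * x + B * f x) = t
    revert t
    decide
  omega

theorem add_self' (n : ℕ) (x : GaloisField 2 n) : x + x = 0 := CharTwo.add_self_eq_zero x

theorem walsh_zero (n i m : ℕ) (hn : 0 < n) (hodd : Odd n) (hmn : m ∣ n)
    (hin : i ≤ n) (hgcd : Nat.gcd i n = 1)
    (f : GaloisField 2 n → GaloisField 2 n) (hf : ∀ x, f x = x ^ (2 ^ i + 1))
    (μ : GaloisField 2 n) (hμ : μ ≠ 0) (a b : GaloisField 2 n) (hb : b ^ 2 ^ m = b)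
    (hab : relTr n m a = b + b ^ 2 ^ (n - i)) (h0 : a ≠ 0 ∨ b ≠ 0) :
    W n f (μ * a) (μ ^ (2 ^ i + 1) * b) = 0 := by
  by_cases hb0 : b = 0
  · have ha : a ≠ 0 := by tauto
    subst hb0
    apply W_zero n f _ _ (μ * a)⁻¹
    intro x
    rw [mul_add, mul_inv_cancel₀ (mul_ne_zero hμ ha), mul_zero, zero_mul, zero_mul, add_zero,
      add_zero, tr_add, tr_one n hn hodd]
  · obtain ⟨w, hw0, hwm, hwb⟩ := gold_root n i m hn hodd hgcd b hb0 hb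
    have hbu : b * w⁻¹ = w ^ 2 ^ i := by
      rw [← hwb, pow_succ]; field_simp
    have hbq : b * (w⁻¹) ^ 2 ^ i = w := by
      rw [← hwb, pow_succ, inv_pow]; field_simp
    have hb1 : b * (w⁻¹) ^ (2 ^ i + 1) = 1 := by
      rw [← hwb, ← mul_pow, mul_inv_cancel₀ hw0, one_pow]
    have hTa : Tr n (a * w⁻¹) = 0 := by
      rw [mul_comm, ← tr_relTr n m hodd hmn w⁻¹ a (by rw [inv_pow, hwm]), hab, mul_add, tr_add,
        mul_comm, hbu, tr_pow, ← tr_pow n i (w⁻¹ * _), mul_pow, ← pow_mul, ← pow_add,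
        Nat.sub_add_cancel hin, pow_card' n hn, mul_comm, hbq]
      exact CharTwo.add_self_eq_zero _
    apply W_zero n f _ _ (μ⁻¹ * w⁻¹)
    intro x
    have key : μ * a * (x + μ⁻¹ * w⁻¹) + μ ^ (2 ^ i + 1) * b * f (x + μ⁻¹ * w⁻¹) =
        (μ * a * x + μ ^ (2 ^ i + 1) * b * f x) + a * w⁻¹ + 1 + (w * (μ * x)) ^ 2 ^ i
          + w * (μ * x) := by
      have e1 : μ * a * (x + μ⁻¹ * w⁻¹) = μ * a * x + a * w⁻¹ := by field_simp
      have e2 : μ ^ (2 ^ i + 1) * b * f (x + μ⁻¹ * w⁻¹) = b * (μ * x + w⁻¹) ^ (2 ^ i + 1) := by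
        rw [hf, mul_right_comm, ← mul_pow, mul_comm, mul_add, mul_inv_cancel_left₀ hμ]
      have e3 : μ ^ (2 ^ i + 1) * b * f x = b * (μ * x) ^ (2 ^ i + 1) := by
        rw [hf, mul_pow]; ring
      have e4 : b * (μ * x + w⁻¹) ^ (2 ^ i + 1) = b * (μ * x) ^ (2 ^ i + 1)
          + (b * w⁻¹) * (μ * x) ^ 2 ^ i + (b * w⁻¹ ^ 2 ^ i) * (μ * x)
          + b * w⁻¹ ^ (2 ^ i + 1) := by
        rw [pow_succ, add_frob, pow_succ, pow_succ]; ring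
      rw [e1, e2, e3, e4, hbu, hbq, hb1, mul_pow]
      ring
    rw [key, tr_add, tr_add, tr_add, tr_add, hTa, tr_pow, tr_one n hn hodd, add_assoc _ (Tr n (w * (μ * x))),
      CharTwo.add_self_eq_zero (Tr n (w * (μ * x)))]
    ring

/-- For `n` odd, `m ∣ n`, `gcd(i,n) = 1` and `μ ≠ 0`, the set
`Z = {(μa, μ^(2^i+1)·b) : a ∈ F, b ∈ F_{2^m}, Tr^n_m(a) = b + b^(1/2^i)}` is a WZ
space of the Gold function `f(x) = x^(2^i+1)`. Here `Tr^n_m` is the relative trace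
`a ↦ ∑_{j<n/m} a^(2^(mj))`, and `b^(1/2^i) = b^(2^(n−i))`. -/
theorem stmt12 (n i m : ℕ) (hn : 0 < n) (hodd : Odd n) (hm : 0 < m) (hmn : m ∣ n)
    (hi : 0 < i) (hin : i ≤ n) (hgcd : Nat.gcd i n = 1)
    (f : GaloisField 2 n → GaloisField 2 n) (hf : ∀ x, f x = x ^ (2 ^ i + 1))
    (μ : GaloisField 2 n) (hμ : μ ≠ 0) :
    ∃ Z : Submodule (ZMod 2) (GaloisField 2 n × GaloisField 2 n),
      (Z : Set (GaloisField 2 n × GaloisField 2 n)) =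
        {p : GaloisField 2 n × GaloisField 2 n |
          ∃ a b : GaloisField 2 n, b ^ (2 ^ m) = b ∧
            (∑ j ∈ Finset.range (n / m), a ^ (2 ^ (m * j))) = b + b ^ (2 ^ (n - i)) ∧
            p = (μ * a, μ ^ (2 ^ i + 1) * b)} ∧
      IsWZSpace n f Z := by
  have hq : μ ^ (2 ^ i + 1) ≠ 0 := pow_ne_zero _ hμ
  let L : GaloisField 2 n →ₗ[ZMod 2] GaloisField 2 n × GaloisField 2 n :=
    ((LinearMap.mulLeft (ZMod 2) μ).comp
      (LinearMap.id + (frobLin n (n - i)).comp (relTr n m))).prod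
    ((LinearMap.mulLeft (ZMod 2) (μ ^ (2 ^ i + 1))).comp (relTr n m))
  have hL : ∀ z, L z = (μ * (z + (relTr n m z) ^ 2 ^ (n - i)),
      μ ^ (2 ^ i + 1) * relTr n m z) := by
    intro z
    simp [L, frobLin_apply]
  have hfix : ∀ b : GaloisField 2 n, b ^ 2 ^ m = b →
      relTr n m (b ^ 2 ^ (n - i)) = b ^ 2 ^ (n - i) := by
    intro b hb
    apply relTr_fix n m hodd hmn
    rw [← pow_mul, mul_comm, pow_mul, hb]
  have hset : ((LinearMap.range L : Submodule _ _) : Set (GaloisField 2 n × GaloisField 2 n)) =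
        {p : GaloisField 2 n × GaloisField 2 n |
          ∃ a b : GaloisField 2 n, b ^ (2 ^ m) = b ∧
            (∑ j ∈ Finset.range (n / m), a ^ (2 ^ (m * j))) = b + b ^ (2 ^ (n - i)) ∧
            p = (μ * a, μ ^ (2 ^ i + 1) * b)} := by
    ext p
    simp only [SetLike.mem_coe, LinearMap.mem_range, Set.mem_setOf_eq, ← relTr_apply]
    constructor
    · rintro ⟨z, rfl⟩
      refine ⟨_, _, relTr_mem n m hn hmn z, ?_, hL z⟩
      rw [map_add, hfix _ (relTr_mem n m hn hmn z)]
    · rintro ⟨a, b, hb, hab, rfl⟩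
      refine ⟨a + b ^ 2 ^ (n - i), ?_⟩
      have hT : relTr n m (a + b ^ 2 ^ (n - i)) = b := by
        rw [map_add, hfix b hb, hab, add_assoc, add_self', add_zero]
      rw [hL, hT, add_assoc, add_self', add_zero]
  refine ⟨LinearMap.range L, hset, ?_, ?_⟩
  · rw [LinearMap.finrank_range_of_inj, GaloisField.finrank 2 hn.ne']
    rw [injective_iff_map_eq_zero]
    intro z hz
    rw [hL, Prod.mk_eq_zero] at hz
    have h2 : relTr n m z = 0 := by simpa [hμ] using hz.2
    have h1 := hz.1
    rw [h2, zero_pow (by positivity), add_zero] at h1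
    simpa [hμ] using h1
  · intro p hp hp0
    have hp' : p ∈ ((LinearMap.range L : Submodule _ _) : Set _) := hp
    rw [hset] at hp'
    obtain ⟨a, b, hb, hab, rfl⟩ := hp'
    rw [← relTr_apply] at hab
    apply walsh_zero n i m hn hodd hmn hin hgcd f hf μ hμ a b hb hab
    by_contra hc
    push Not at hc
    apply hp0
    rw [hc.1, hc.2, mul_zero, mul_zero]
    rfl
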